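/- Let a ≥ 2 and 0 ≤ j ≤ a-1 be integers, ω = exp(2πi/a), z ≠ 0, |q| < 1. Then ∑_{n ∈ ℤ^a, n·1=0} z^{n_j} ω^{b_a·n} q^{(1/2) n·n} = E(q)^{a-2} E(q^a) ∏_{n=1}^∞ (1 - z q^{n-1})(1 - z^{-1} q^n) / ((1 - z q^{a(n-1)})(1 - z^{-1} q^{an})). -/

import Mathlib

/-- `E(q) = ∏_{n ≥ 1} (1 - qⁿ)`. -/
noncomputable def Eprod (q : ℂ) : ℂ := ∏' n : ℕ, (1 - q ^ (n + 1))

open Filter Topology Finset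

/-- The finite `q`-Pochhammer symbol `(q; q)_n = (1 - q) ⋯ (1 - qⁿ)`. -/
def qFactorial (q : ℂ) (n : ℕ) : ℂ := ∏ i ∈ range n, (1 - q ^ (i + 1))

/-- The Gaussian binomial coefficient, defined by its Pascal recursion. -/
def gaussBinom (q : ℂ) : ℕ → ℕ → ℂ
  | _, 0 => 1
  | 0, _ + 1 => 0
  | n + 1, k + 1 => q ^ (k + 1) * gaussBinom q n (k + 1) + gaussBinom q n k

lemma gaussBinom_zero_right (q : ℂ) (n : ℕ) : gaussBinom q n 0 = 1 := by
  cases n <;> rfl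

lemma gaussBinom_eq_zero_of_lt (q : ℂ) {n k : ℕ} (h : n < k) : gaussBinom q n k = 0 := by
  induction n generalizing k with
  | zero => obtain ⟨k, rfl⟩ := Nat.exists_eq_succ_of_ne_zero h.ne'; rfl
  | succ n ih =>
    obtain ⟨k, rfl⟩ := Nat.exists_eq_succ_of_ne_zero (Nat.ne_zero_of_lt h)
    simp [gaussBinom, ih (show n < k by omega), ih (show n < k + 1 by omega)]

lemma gaussBinom_self (q : ℂ) (n : ℕ) : gaussBinom q n n = 1 := by
  induction n with
  | zero => rfl
  | succ n ih => simp [gaussBinom, ih, gaussBinom_eq_zero_of_lt q (Nat.lt_succ_self n)]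

lemma gaussBinom_mul_qFactorial (q : ℂ) (k l : ℕ) :
    gaussBinom q (k + l) k * (qFactorial q k * qFactorial q l) = qFactorial q (k + l) := by
  induction h : k + l generalizing k l with
  | zero =>
    obtain ⟨rfl, rfl⟩ : k = 0 ∧ l = 0 := by omega
    simp [gaussBinom, qFactorial]
  | succ n ih =>
    rcases k with _ | k
    · simp [gaussBinom_zero_right, show l = n + 1 by omega, qFactorial]
    rcases l with _ | l
    · simp [show k = n by omega, gaussBinom_self, qFactorial]
    have h₁ := ih (k + 1) l (by omega)
    have h₂ := ih k (l + 1) (by omega)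
    have hn : n = k + 1 + l := by omega
    simp only [qFactorial, prod_range_succ, gaussBinom] at h₁ h₂ ⊢
    have e : q ^ (n + 1) = q ^ (k + 1) * q ^ (l + 1) := by rw [hn]; ring
    rw [e]
    linear_combination q ^ (k + 1) * (1 - q ^ (l + 1)) * h₁ + (1 - q ^ (k + 1)) * h₂

/-- Cauchy's `q`-binomial theorem. -/
lemma prod_one_add_mul_pow_eq_sum_gaussBinom (q x : ℂ) (N : ℕ) :
    ∏ k ∈ range N, (1 + x * q ^ k) =
      ∑ j ∈ range (N + 1), gaussBinom q N j * q ^ j.choose 2 * x ^ j := by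
  induction N generalizing x with
  | zero => simp [gaussBinom]
  | succ N ih =>
    have h₁ : ∏ k ∈ range N, (1 + x * q ^ (k + 1)) =
        ∑ j ∈ range (N + 1), gaussBinom q N j * q ^ j.choose 2 * (x * q) ^ j := by
      rw [← ih]
      exact prod_congr rfl fun k _ => by ring
    rw [prod_range_succ', h₁, sum_range_succ' _ (N + 1)]
    have h₂ : ∀ j ∈ range (N + 1),
        gaussBinom q (N + 1) (j + 1) * q ^ (j + 1).choose 2 * x ^ (j + 1) =
          gaussBinom q N (j + 1) * q ^ (j + 1).choose 2 * (x * q) ^ (j + 1) +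
            gaussBinom q N j * q ^ j.choose 2 * (x * q) ^ j * x := by
      intro j _
      rw [gaussBinom, Nat.choose_succ_succ' j 1, Nat.choose_one_right]
      ring
    rw [sum_congr rfl h₂, sum_add_distrib, ← sum_mul]
    have h₃ := sum_range_succ' (fun j => gaussBinom q N j * q ^ j.choose 2 * (x * q) ^ j) (N + 1)
    rw [sum_range_succ] at h₃
    simp only [gaussBinom_eq_zero_of_lt q (Nat.lt_succ_self N)] at h₃
    simp only [gaussBinom_zero_right] at h₃ ⊢
    linear_combination h₃

/-- The triangular exponent `m (m - 1) / 2`. -/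
def tri (m : ℤ) : ℤ := m * (m - 1) / 2

lemma two_mul_tri (m : ℤ) : 2 * tri m = m * (m - 1) :=
  Int.mul_ediv_cancel' (by
    have := Int.even_mul_succ_self (m - 1)
    rw [sub_add_cancel, mul_comm] at this
    exact this.two_dvd)

lemma natCast_choose_two (n : ℕ) : ((n.choose 2 : ℕ) : ℤ) = tri n := by
  have h := two_mul_tri n
  induction n with
  | zero => simp [tri]
  | succ n ih =>
    have h' := two_mul_tri n
    have := ih h'
    rw [Nat.choose_succ_succ' n 1, Nat.choose_one_right]
    push_cast at *
    linarith

/-- The general term of the theta series `∑ (-x)^m q^(m(m-1)/2)`. -/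
noncomputable def thetaTerm (q x : ℂ) (m : ℤ) : ℂ := (-x) ^ m * q ^ tri m

lemma summable_norm_thetaTerm {q : ℂ} (hq0 : q ≠ 0) (hq : ‖q‖ < 1) {x : ℂ} (hx : x ≠ 0) :
    Summable fun m => ‖thetaTerm q x m‖ := by
  have key (y : ℝ) (hy : y ≠ 0) (c : ℕ) (s : ℕ → ℤ)
      (hs : ∀ n : ℕ, s (n + 1) = s n + (n + c : ℕ)) :
      Summable fun n : ℕ => y ^ n * ‖q‖ ^ s n := by
    have hq0' : ‖q‖ ≠ 0 := norm_ne_zero_iff.mpr hq0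
    refine summable_of_ratio_test_tendsto_lt_one zero_lt_one
      (.of_forall fun n => mul_ne_zero (pow_ne_zero _ hy) (zpow_ne_zero _ hq0')) ?_
    have : ∀ n : ℕ, ‖y ^ (n + 1) * ‖q‖ ^ s (n + 1)‖ / ‖y ^ n * ‖q‖ ^ s n‖ = |y| * ‖q‖ ^ c * ‖q‖ ^ n := by
      intro n
      rw [← norm_div, hs, zpow_add₀ hq0', pow_succ, zpow_natCast]
      have h₁ := pow_ne_zero n hy
      have h₂ := zpow_ne_zero (s n) hq0'
      rw [show y ^ n * y * (‖q‖ ^ s n * ‖q‖ ^ (n + c)) / (y ^ n * ‖q‖ ^ s n) =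
        y * ‖q‖ ^ c * ‖q‖ ^ n by field_simp; ring]
      simp
    simp only [this]
    simpa using (tendsto_pow_atTop_nhds_zero_of_lt_one (norm_nonneg q) hq).const_mul (|y| * ‖q‖ ^ c)
  refine .of_nat_of_neg ?_ ?_
  · refine (key ‖x‖ (norm_ne_zero_iff.mpr hx) 0 (fun n => tri n) fun n => ?_).congr fun n => ?_
    · have h₁ := two_mul_tri n
      have h₂ := two_mul_tri (n + 1 : ℕ)
      push_cast at *
      linarith
    · simp [thetaTerm]
  · refine (key (‖x‖⁻¹) (inv_ne_zero (norm_ne_zero_iff.mpr hx)) 1 (fun n => tri (-n))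
      fun n => ?_).congr fun n => ?_
    · have h₁ := two_mul_tri (-n)
      have h₂ := two_mul_tri (-(n + 1 : ℕ))
      push_cast at *
      linarith
    · simp [thetaTerm]

lemma thetaTerm_sub {q x : ℂ} (hq0 : q ≠ 0) (hx : x ≠ 0) (n j : ℕ) :
    thetaTerm q x (j - n) =
      thetaTerm q x (-n) * (q ^ j.choose 2 * (-x * (q ^ n)⁻¹) ^ j) := by
  have h : tri (j - n) = tri (-n) + tri j + -(n * j : ℕ) := by
    have h₁ := two_mul_tri (j - n)
    have h₂ := two_mul_tri (-n)
    have h₃ := two_mul_tri j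
    push_cast
    linarith
  rw [thetaTerm, thetaTerm, h, zpow_add₀ hq0, zpow_add₀ hq0, ← natCast_choose_two j,
    sub_eq_neg_add, zpow_add₀ (neg_ne_zero.mpr hx), zpow_neg q, zpow_natCast, zpow_natCast,
    zpow_natCast, mul_pow, inv_pow, pow_mul]
  ring

lemma prod_mul_thetaTerm_neg {q x : ℂ} (hq0 : q ≠ 0) (hx : x ≠ 0) (n : ℕ) :
    (∏ k ∈ range n, (-x * (q ^ (k + 1))⁻¹)) * thetaTerm q x (-n) = 1 := by
  induction n with
  | zero => simp [thetaTerm, tri]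
  | succ n ih =>
    have h : tri (-(n + 1 : ℕ)) = tri (-n) + (n + 1 : ℕ) := by
      have h₁ := two_mul_tri (-(n + 1 : ℕ))
      have h₂ := two_mul_tri (-n)
      push_cast at *
      linarith
    rw [prod_range_succ, ← ih, thetaTerm, thetaTerm, h, zpow_add₀ hq0, zpow_natCast,
      show (-((n + 1 : ℕ) : ℤ)) = -n + -1 by push_cast; ring,
      zpow_add₀ (neg_ne_zero.mpr hx), zpow_neg_one]
    have := pow_ne_zero (n + 1) hq0
    field_simp

/-- The finite form of the Jacobi triple product. -/
lemma prod_theta_eq_sum {q x : ℂ} (hq0 : q ≠ 0) (hx : x ≠ 0) (n : ℕ) :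
    ∏ k ∈ range n, ((1 - x * q ^ k) * (1 - x⁻¹ * q ^ (k + 1))) =
      ∑ j ∈ range (2 * n + 1), gaussBinom q (2 * n) j * thetaTerm q x (j - n) := by
  have h := prod_one_add_mul_pow_eq_sum_gaussBinom q (-x * (q ^ n)⁻¹) (2 * n)
  have hA : ∏ k ∈ range n, (1 + -x * (q ^ n)⁻¹ * q ^ k) =
      (∏ k ∈ range n, (-x * (q ^ (k + 1))⁻¹)) * ∏ k ∈ range n, (1 - x⁻¹ * q ^ (k + 1)) := by
    rw [← prod_range_reflect, ← prod_mul_distrib]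
    refine prod_congr rfl fun k hk => ?_
    have hk : k + 1 ≤ n := mem_range.mp hk
    obtain ⟨l, rfl⟩ := Nat.exists_eq_add_of_le hk
    rw [show k + 1 + l - 1 - k = l by omega, pow_add]
    have := pow_ne_zero l hq0
    have := pow_ne_zero (k + 1) hq0
    field_simp
    ring
  have hB : ∏ k ∈ range n, (1 + -x * (q ^ n)⁻¹ * q ^ (n + k)) =
      ∏ k ∈ range n, (1 - x * q ^ k) := by
    refine prod_congr rfl fun k _ => ?_
    have := pow_ne_zero n hq0
    rw [pow_add]
    field_simp
    ring
  rw [show (∏ k ∈ range (2 * n), (1 + -x * (q ^ n)⁻¹ * q ^ k)) = _ from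
    (two_mul n ▸ prod_range_add _ n n), hA, hB] at h
  calc _ = thetaTerm q x (-n) * ((∏ k ∈ range n, (-x * (q ^ (k + 1))⁻¹)) *
        (∏ k ∈ range n, (1 - x⁻¹ * q ^ (k + 1))) * ∏ k ∈ range n, (1 - x * q ^ k)) := by
        rw [prod_mul_distrib]
        linear_combination -(∏ k ∈ range n, (1 - x * q ^ k)) *
          (∏ k ∈ range n, (1 - x⁻¹ * q ^ (k + 1))) * prod_mul_thetaTerm_neg hq0 hx n
    _ = _ := by
        rw [h, mul_sum]
        refine sum_congr rfl fun j _ => ?_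
        rw [thetaTerm_sub hq0 hx]
        ring

lemma summable_norm_mul_pow {q : ℂ} (hq : ‖q‖ < 1) (y : ℂ) :
    Summable fun n : ℕ => ‖-(y * q ^ n)‖ := by
  simpa using (summable_geometric_of_lt_one (norm_nonneg q) hq).mul_left ‖y‖

lemma multipliable_one_sub_mul_pow {q : ℂ} (hq : ‖q‖ < 1) (y : ℂ) :
    Multipliable fun n : ℕ => 1 - y * q ^ n := by
  simpa only [sub_eq_add_neg] using
    multipliable_one_add_of_summable (summable_norm_mul_pow hq y)

lemma multipliable_one_sub_mul_pow_succ {q : ℂ} (hq : ‖q‖ < 1) (y : ℂ) :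
    Multipliable fun n : ℕ => 1 - y * q ^ (n + 1) :=
  (multipliable_one_sub_mul_pow hq (y * q)).congr fun n => by ring

lemma multipliable_one_sub_pow_succ {q : ℂ} (hq : ‖q‖ < 1) :
    Multipliable fun n : ℕ => 1 - q ^ (n + 1) := by
  simpa using multipliable_one_sub_mul_pow_succ hq 1

lemma tprod_one_sub_mul_pow_ne_zero {q : ℂ} (hq : ‖q‖ < 1) (y : ℂ)
    (h : ∀ n : ℕ, y * q ^ n ≠ 1) : ∏' n : ℕ, (1 - y * q ^ n) ≠ 0 := by
  simpa only [sub_eq_add_neg] using tprod_one_add_ne_zero_of_summable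
    (fun n => by rw [← sub_eq_add_neg]; exact sub_ne_zero.mpr (h n).symm)
    (summable_norm_mul_pow hq y)

lemma pow_succ_ne_one {q : ℂ} (hq : ‖q‖ < 1) (n : ℕ) : q ^ (n + 1) ≠ 1 := by
  intro h
  have := pow_lt_one₀ (norm_nonneg q) hq n.succ_ne_zero
  rw [← norm_pow, h, norm_one] at this
  exact lt_irrefl _ this

lemma Eprod_ne_zero {q : ℂ} (hq : ‖q‖ < 1) : Eprod q ≠ 0 := by
  have := tprod_one_sub_mul_pow_ne_zero hq q fun n => by
    rw [← pow_succ']; exact pow_succ_ne_one hq n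
  simpa only [Eprod, pow_succ'] using this

lemma tendsto_qFactorial {q : ℂ} (hq : ‖q‖ < 1) :
    Tendsto (qFactorial q) atTop (𝓝 (Eprod q)) :=
  (multipliable_one_sub_pow_succ hq).hasProd.tendsto_prod_nat

lemma qFactorial_ne_zero {q : ℂ} (hq : ‖q‖ < 1) (n : ℕ) : qFactorial q n ≠ 0 :=
  prod_ne_zero_iff.mpr fun k _ => sub_ne_zero.mpr (pow_succ_ne_one hq k).symm

lemma gaussBinom_add_eq_div {q : ℂ} (hq : ‖q‖ < 1) (k l : ℕ) :
    gaussBinom q (k + l) k = qFactorial q (k + l) * (qFactorial q k)⁻¹ * (qFactorial q l)⁻¹ := by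
  rw [← gaussBinom_mul_qFactorial]
  have := qFactorial_ne_zero hq k
  have := qFactorial_ne_zero hq l
  field_simp

lemma exists_norm_gaussBinom_le {q : ℂ} (hq : ‖q‖ < 1) :
    ∃ C, 0 ≤ C ∧ ∀ n k, ‖gaussBinom q n k‖ ≤ C := by
  obtain ⟨A, hA⟩ := (tendsto_qFactorial hq).norm.bddAbove_range
  obtain ⟨B, hB⟩ := ((tendsto_qFactorial hq).inv₀ (Eprod_ne_zero hq)).norm.bddAbove_range
  have hA (n : ℕ) : ‖qFactorial q n‖ ≤ A := hA ⟨n, rfl⟩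
  have hB (n : ℕ) : ‖(qFactorial q n)⁻¹‖ ≤ B := hB ⟨n, rfl⟩
  have hA0 : 0 ≤ A := (norm_nonneg _).trans (hA 0)
  have hB0 : 0 ≤ B := (norm_nonneg _).trans (hB 0)
  refine ⟨A * B * B, by positivity, fun n k => ?_⟩
  rcases lt_or_ge n k with h | h
  · rw [gaussBinom_eq_zero_of_lt q h, norm_zero]
    positivity
  · obtain ⟨l, rfl⟩ := Nat.exists_eq_add_of_le h
    rw [gaussBinom_add_eq_div hq, norm_mul, norm_mul]
    gcongr
    exacts [hA _, hB _, hB _]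

/-- The product side of the Jacobi triple product, without the factor `E(q)`. -/
noncomputable def thetaProd (q x : ℂ) : ℂ :=
  ∏' n : ℕ, ((1 - x * q ^ n) * (1 - x⁻¹ * q ^ (n + 1)))

lemma multipliable_thetaProd {q : ℂ} (hq : ‖q‖ < 1) (x : ℂ) :
    Multipliable fun n : ℕ => (1 - x * q ^ n) * (1 - x⁻¹ * q ^ (n + 1)) :=
  (multipliable_one_sub_mul_pow hq x).mul (multipliable_one_sub_mul_pow_succ hq x⁻¹)

/-- The **Jacobi triple product** identity. -/
lemma tsum_thetaTerm {q x : ℂ} (hq0 : q ≠ 0) (hq : ‖q‖ < 1) (hx : x ≠ 0) :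
    ∑' m, thetaTerm q x m = Eprod q * thetaProd q x := by
  obtain ⟨C, hC0, hC⟩ := exists_norm_gaussBinom_le hq
  let c (n : ℕ) (m : ℤ) : ℂ := if -(n : ℤ) ≤ m then gaussBinom q (2 * n) (m + n).toNat else 0
  have hc (n : ℕ) : ∑' m, c n m * thetaTerm q x m =
      ∏ k ∈ range n, ((1 - x * q ^ k) * (1 - x⁻¹ * q ^ (k + 1))) := by
    have hinj : Function.Injective fun j : ℕ => (j : ℤ) - n := fun i j h => by
      simpa using h
    rw [prod_theta_eq_sum hq0 hx, ← hinj.tsum_eq, tsum_eq_sum (s := range (2 * n + 1))]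
    · refine sum_congr rfl fun j _ => ?_
      simp [c]
    · intro j hj
      have : 2 * n < j := by
        have := mt mem_range.mpr hj
        omega
      simp [c, gaussBinom_eq_zero_of_lt q this]
    · intro m hm
      have : -(n : ℤ) ≤ m := by
        by_contra h
        simp [c, h] at hm
      exact ⟨(m + n).toNat, by simp only; omega⟩
  have hlim : Tendsto (fun n => ∑' m, c n m * thetaTerm q x m) atTop
      (𝓝 (∑' m, (Eprod q)⁻¹ * thetaTerm q x m)) := by
    refine tendsto_tsum_of_dominated_convergence
      ((summable_norm_thetaTerm hq0 hq hx).mul_left C) (fun m => ?_) (.of_forall fun n m => ?_)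
    · refine Tendsto.mul_const _ ?_
      have hE := Eprod_ne_zero hq
      have h₁ : Tendsto (fun n : ℕ => (m + n).toNat) atTop atTop :=
        tendsto_atTop.mpr fun b => eventually_atTop.mpr ⟨b + m.natAbs, fun n hn => by omega⟩
      have h₂ : Tendsto (fun n : ℕ => (n - m).toNat) atTop atTop :=
        tendsto_atTop.mpr fun b => eventually_atTop.mpr ⟨b + m.natAbs, fun n hn => by omega⟩
      have h₃ : Tendsto (fun n : ℕ => 2 * n) atTop atTop :=
        tendsto_atTop.mpr fun b => eventually_atTop.mpr ⟨b, fun n hn => by omega⟩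
      have h := ((tendsto_qFactorial hq).comp h₃).mul
        (((tendsto_qFactorial hq).comp h₁).inv₀ hE) |>.mul
        (((tendsto_qFactorial hq).comp h₂).inv₀ hE)
      rw [mul_inv_cancel₀ hE, one_mul] at h
      refine h.congr' (eventually_atTop.mpr ⟨m.natAbs, fun n hn => ?_⟩)
      have hs : 2 * n = (m + n).toNat + (n - m).toNat := by omega
      simp only [Function.comp_apply, c, if_pos (show -(n : ℤ) ≤ m by omega)]
      rw [hs, gaussBinom_add_eq_div hq]
    · rw [norm_mul]
      gcongr
      simp only [c]
      split_ifs
      · exact hC _ _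
      · simpa using hC0
  simp only [hc] at hlim
  have := tendsto_nhds_unique hlim (multipliable_thetaProd hq x).hasProd.tendsto_prod_nat
  rw [tsum_mul_left] at this
  rw [thetaProd, ← this, mul_inv_cancel_left₀ (Eprod_ne_zero hq)]

lemma zpow_finsetSum₀ {ι : Type*} {x : ℂ} (hx : x ≠ 0) (s : Finset ι) (f : ι → ℤ) :
    x ^ (∑ i ∈ s, f i) = ∏ i ∈ s, x ^ f i := by
  classical
  induction s using Finset.induction_on with
  | empty => simp
  | insert i s hi ih => rw [sum_insert hi, prod_insert hi, zpow_add₀ hx, ih]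

lemma summable_norm_prod_and_tsum_prod {κ : Type*} {n : ℕ} (f : Fin n → κ → ℂ)
    (hf : ∀ i, Summable fun m => ‖f i m‖) :
    (Summable fun p : Fin n → κ => ‖∏ i, f i (p i)‖) ∧
      ∑' p : Fin n → κ, ∏ i, f i (p i) = ∏ i, ∑' m, f i m := by
  induction n with
  | zero => exact ⟨.of_finite, by simp⟩
  | succ n ih =>
    obtain ⟨h₁, h₂⟩ := ih (fun i => f i.succ) fun i => hf i.succ
    let e : κ × (Fin n → κ) ≃ (Fin (n + 1) → κ) := Fin.consEquiv fun _ => κ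
    have he (x : κ × (Fin n → κ)) :
        ∏ i, f i (e x i) = f 0 x.1 * ∏ i : Fin n, f i.succ (x.2 i) := by
      simp [e, Fin.prod_univ_succ, Fin.consEquiv]
    constructor
    · rw [← e.summable_iff]
      refine ((hf 0).mul_norm h₁).congr fun x => ?_
      simp only [Function.comp_apply, he]
    · rw [← e.tsum_eq, Fin.prod_univ_succ, ← h₂, tsum_mul_tsum_of_summable_norm (hf 0) h₁]
      exact tsum_congr he

lemma thetaTerm_mul (q c x : ℂ) (m : ℤ) : thetaTerm q (c * x) m = c ^ m * thetaTerm q x m := by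
  rw [thetaTerm, thetaTerm, ← mul_neg, mul_zpow, mul_assoc]

lemma IsPrimitiveRoot.sum_pow_zpow {ζ : ℂ} {a : ℕ} (hζ : IsPrimitiveRoot ζ a) (s : ℤ) :
    ∑ k ∈ range a, (ζ ^ k) ^ s = if (a : ℤ) ∣ s then (a : ℂ) else 0 := by
  have h : ∀ k : ℕ, (ζ ^ k) ^ s = (ζ ^ s) ^ k := fun k => by
    rw [← zpow_natCast, ← zpow_natCast, ← zpow_mul, ← zpow_mul, mul_comm]
  simp only [h]
  split_ifs with hs
  · simp [(hζ.zpow_eq_one_iff_dvd s).mpr hs]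
  · have h₁ : ζ ^ s ≠ 1 := mt (hζ.zpow_eq_one_iff_dvd s).mp hs
    rw [geom_sum_eq h₁, ← h, hζ.pow_eq_one, one_zpow, sub_self, zero_div]

/-- Roots of unity extract from a product of theta series the terms whose index sum is divisible
by `a`. -/
lemma sum_prod_tsum_thetaTerm {q ζ : ℂ} {a : ℕ} (hq0 : q ≠ 0) (hq : ‖q‖ < 1) (ha : a ≠ 0)
    (hζ : IsPrimitiveRoot ζ a) (u : Fin a → ℂ) (hu : ∀ i, u i ≠ 0) :
    ∑ k ∈ range a, ∏ i, ∑' m, thetaTerm q (ζ ^ k * u i) m =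
      a * ∑' p : {p : Fin a → ℤ // (a : ℤ) ∣ ∑ i, p i}, ∏ i, thetaTerm q (u i) (p.1 i) := by
  have hζ0 : ζ ≠ 0 := hζ.ne_zero ha
  have hk (k : ℕ) := summable_norm_prod_and_tsum_prod (fun i => thetaTerm q (ζ ^ k * u i))
    fun i => summable_norm_thetaTerm hq0 hq (mul_ne_zero (pow_ne_zero k hζ0) (hu i))
  calc _ = ∑ k ∈ range a, ∑' p : Fin a → ℤ, ∏ i, thetaTerm q (ζ ^ k * u i) (p i) :=
        sum_congr rfl fun k _ => (hk k).2.symm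
    _ = ∑' p : Fin a → ℤ, ∑ k ∈ range a, ∏ i, thetaTerm q (ζ ^ k * u i) (p i) :=
        (Summable.tsum_finsetSum fun k _ => (hk k).1.of_norm).symm
    _ = ∑' p : Fin a → ℤ, {p : Fin a → ℤ | (a : ℤ) ∣ ∑ i, p i}.indicator
          (fun p => a * ∏ i, thetaTerm q (u i) (p i)) p := by
        refine tsum_congr fun p => ?_
        have h (k : ℕ) : ∏ i, thetaTerm q (ζ ^ k * u i) (p i) =
            (ζ ^ k) ^ (∑ i, p i) * ∏ i, thetaTerm q (u i) (p i) := by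
          simp only [thetaTerm_mul, prod_mul_distrib, zpow_finsetSum₀ (pow_ne_zero k hζ0)]
        simp only [h, ← sum_mul, hζ.sum_pow_zpow, Set.indicator_apply, Set.mem_ofPred_eq, ite_mul,
          zero_mul]
    _ = _ := by
        rw [← _root_.tsum_subtype, tsum_mul_left]
        rfl

/-- Decomposition of the vectors whose coordinate sum is divisible by `a` into a vector with
coordinate sum zero and a constant vector. -/
def sumZeroProdEquiv {a : ℕ} (ha : a ≠ 0) :
    {v : Fin a → ℤ // ∑ i, v i = 0} × ℤ ≃ {p : Fin a → ℤ // (a : ℤ) ∣ ∑ i, p i} where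
  toFun x := ⟨fun i => x.1.1 i + x.2, by simp [sum_add_distrib, x.1.2]⟩
  invFun p := (⟨fun i => p.1 i - (∑ i, p.1 i) / a, by
    simp [sum_sub_distrib, Int.mul_ediv_cancel' p.2]⟩, (∑ i, p.1 i) / a)
  left_inv x := by
    have h : (∑ i, (x.1.1 i + x.2)) / (a : ℤ) = x.2 := by
      simp [sum_add_distrib, x.1.2, ha]
    ext <;> simp [h]
  right_inv p := by
    ext
    simp

lemma IsPrimitiveRoot.prod_sub_pow_mul {ζ : ℂ} {a : ℕ} (ha : a ≠ 0) (hζ : IsPrimitiveRoot ζ a)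
    (x y : ℂ) : ∏ i : Fin a, (x - ζ ^ (i : ℕ) * y) = x ^ a - y ^ a := by
  have h := congrArg (Polynomial.eval x)
    (X_pow_sub_C_eq_prod hζ (Nat.pos_of_ne_zero ha) (rfl : y ^ a = y ^ a))
  rw [Polynomial.eval_prod] at h
  simp only [Polynomial.eval_sub, Polynomial.eval_pow, Polynomial.eval_X, Polynomial.eval_C] at h
  rw [h, ← Fin.prod_univ_eq_prod_range (fun i => x - ζ ^ i * y)]

open Polynomial in
lemma IsPrimitiveRoot.prod_erase_one_sub {ζ : ℂ} {a : ℕ} (hζ : IsPrimitiveRoot ζ a)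
    (j : Fin a) (x : ℂ) :
    ∏ i ∈ univ.erase j, (1 - ζ ^ (i : ℕ) * (ζ ^ (j : ℕ))⁻¹ * x) = ∑ l ∈ range a, x ^ l := by
  have ha : a ≠ 0 := by rintro rfl; exact j.elim0
  have hζ0 : ζ ≠ 0 := hζ.ne_zero ha
  have key : (1 - X : ℂ[X]) * ∏ i ∈ univ.erase j, (1 - C (ζ ^ (i : ℕ) * (ζ ^ (j : ℕ))⁻¹) * X) =
      (1 - X) * ∑ l ∈ range a, X ^ l := by
    rw [mul_neg_geom_sum]
    refine Polynomial.funext fun y => ?_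
    have h₁ := mul_prod_erase univ
      (fun i : Fin a => 1 - ζ ^ (i : ℕ) * ((ζ ^ (j : ℕ))⁻¹ * y)) (mem_univ j)
    have h₂ : ((ζ ^ (j : ℕ))⁻¹ * y) ^ a = y ^ a := by
      rw [mul_pow, inv_pow, ← pow_mul, mul_comm, pow_mul', hζ.pow_eq_one, one_pow, inv_one, mul_one]
    rw [hζ.prod_sub_pow_mul ha, h₂, mul_inv_cancel_left₀ (pow_ne_zero _ hζ0)] at h₁
    simpa [eval_prod, mul_assoc] using h₁
  have h1X : (1 - X : ℂ[X]) ≠ 0 := by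
    rw [← neg_ne_zero, neg_sub]
    exact X_sub_C_ne_zero 1
  have := congrArg (eval x) (mul_left_cancel₀ h1X key)
  simpa [eval_prod, eval_finsetSum] using this

lemma thetaProd_one (q : ℂ) : thetaProd q 1 = 0 :=
  tprod_of_exists_eq_zero ⟨0, by simp⟩

lemma prod_erase_thetaProd {q ζ : ℂ} {a : ℕ} (hq : ‖q‖ < 1) (hζ : IsPrimitiveRoot ζ a)
    (j : Fin a) :
    ∏ i ∈ univ.erase j, thetaProd q (ζ ^ (i : ℕ) * (ζ ^ (j : ℕ))⁻¹) =
      a * (Eprod (q ^ a) / Eprod q) ^ 2 := by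
  have ha : a ≠ 0 := by rintro rfl; exact j.elim0
  let S (x : ℂ) : ℂ := ∑ l ∈ range a, x ^ l
  have hqa : ‖q ^ a‖ < 1 := by
    rw [norm_pow]
    exact pow_lt_one₀ (norm_nonneg q) hq ha
  have hS (n : ℕ) : S (q ^ (n + 1)) = (1 - (q ^ a) ^ (n + 1)) / (1 - q ^ (n + 1)) := by
    rw [eq_div_iff (sub_ne_zero.mpr (pow_succ_ne_one hq n).symm), geom_sum_mul_neg, ← pow_mul,
      ← pow_mul, mul_comm]
  have hm₁ := multipliable_one_sub_pow_succ hqa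
  have hm₂ := multipliable_one_sub_pow_succ hq
  have hm : Multipliable fun n : ℕ => S (q ^ (n + 1)) := by
    simpa only [hS] using hm₁.div₀ hm₂ (Eprod_ne_zero hq)
  have hval : ∏' n : ℕ, S (q ^ (n + 1)) = Eprod (q ^ a) / Eprod q := by
    simp only [hS]
    exact hm₁.tprod_div₀ hm₂ (Eprod_ne_zero hq)
  have hm' : Multipliable fun n : ℕ => S (q ^ n) := by
    have aux (f : ℕ → ℂ) (hf : Multipliable fun n => f (n + 1)) : Multipliable f :=
      hf.hasProd.prod_range_mul.multipliable
    exact aux _ hm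
  simp only [thetaProd]
  rw [← Multipliable.tprod_finsetProd fun i _ => multipliable_thetaProd hq _]
  have hn (n : ℕ) : ∏ i ∈ univ.erase j, ((1 - ζ ^ (i : ℕ) * (ζ ^ (j : ℕ))⁻¹ * q ^ n) *
      (1 - (ζ ^ (i : ℕ) * (ζ ^ (j : ℕ))⁻¹)⁻¹ * q ^ (n + 1))) = S (q ^ n) * S (q ^ (n + 1)) := by
    have h := hζ.inv.prod_erase_one_sub j (q ^ (n + 1))
    simp only [inv_pow, ← mul_inv] at h
    rw [prod_mul_distrib, hζ.prod_erase_one_sub, h]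
  simp only [hn]
  rw [hm'.tprod_mul hm, tprod_eq_zero_mul' (f := fun n => S (q ^ n)) hm, hval]
  simp [S]
  ring

lemma prod_thetaTerm_add {q ζ z : ℂ} {a : ℕ} (hq0 : q ≠ 0) (hz : z ≠ 0)
    (hζ : IsPrimitiveRoot ζ a) (j : Fin a) (v : Fin a → ℤ) (hv : ∑ i, v i = 0) (m : ℤ) :
    ∏ i : Fin a, thetaTerm q (ζ ^ (i : ℕ) * if i = j then z else 1) (v i + m) =
      z ^ v j * ζ ^ (∑ i, (i.1 : ℤ) * v i) * q ^ ((∑ i, v i ^ 2) / 2) * thetaTerm (q ^ a) z m := by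
  have ha : a ≠ 0 := by rintro rfl; exact j.elim0
  have hζ0 : ζ ≠ 0 := hζ.ne_zero ha
  set u : Fin a → ℂ := fun i => ζ ^ (i : ℕ) * if i = j then z else 1 with hu
  have hu0 (i : Fin a) : -u i ≠ 0 := by
    simp only [hu]
    split_ifs <;> simp [hζ0, hz]
  have hexp : ∑ i, tri (v i + m) = (∑ i, v i ^ 2) / 2 + a * tri m := by
    have h₁ : ∑ i, 2 * tri (v i + m) = ∑ i, v i ^ 2 + a * (2 * tri m) := by
      simp only [two_mul_tri]
      have (i : Fin a) : (v i + m) * (v i + m - 1) =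
        v i ^ 2 + (2 * m - 1) * v i + m * (m - 1) := by ring
      simp [this, sum_add_distrib, ← mul_sum, hv]
    rw [← mul_sum] at h₁
    have h₂ : ∑ i, v i ^ 2 = 2 * (∑ i, tri (v i + m) - a * tri m) := by linarith
    rw [h₂, Int.mul_ediv_cancel_left _ two_ne_zero]
    ring
  have h₁ : ∏ i, (-u i) = -z := by
    have := hζ.prod_sub_pow_mul ha 0 1
    simp only [mul_one, zero_sub, one_pow, zero_pow ha] at this
    simp only [hu, ← neg_mul, prod_mul_distrib, this]
    simp
  have h₂ : ∏ i, (-u i) ^ v i = z ^ v j * ζ ^ (∑ i, (i.1 : ℤ) * v i) := by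
    have hw : ∏ i, (if i = j then z else 1) ^ v i = z ^ v j := by
      rw [prod_eq_single j (fun i _ hi => by simp [hi]) (by simp), if_pos rfl]
    have hs : ∏ i, (-1 : ℂ) ^ v i = 1 := by
      rw [← zpow_finsetSum₀ (by norm_num), hv, zpow_zero]
    have (i : Fin a) : (-u i) ^ v i =
        (-1) ^ v i * ζ ^ ((i.1 : ℤ) * v i) * (if i = j then z else 1) ^ v i := by
      rw [hu, ← neg_one_mul, mul_zpow, mul_zpow, zpow_mul, zpow_natCast, mul_assoc]
    simp only [this, prod_mul_distrib, hw, hs, ← zpow_finsetSum₀ hζ0]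
    ring
  change ∏ i, thetaTerm q (u i) (v i + m) = _
  simp only [thetaTerm, prod_mul_distrib, ← zpow_finsetSum₀ hq0, hexp,
    zpow_add₀ (hu0 _), prod_zpow, h₁, h₂, zpow_add₀ hq0, zpow_mul, zpow_natCast]
  ring

lemma summable_prod_thetaTerm {q : ℂ} {a : ℕ} (hq0 : q ≠ 0) (hq : ‖q‖ < 1)
    (u : Fin a → ℂ) (hu : ∀ i, u i ≠ 0) :
    Summable fun p : Fin a → ℤ => ∏ i, thetaTerm q (u i) (p i) :=
  (summable_norm_prod_and_tsum_prod _ fun i =>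
    summable_norm_thetaTerm hq0 hq (hu i)).1.of_norm

lemma sum_prod_theta_eq_single {q ζ z : ℂ} {a : ℕ} (hq0 : q ≠ 0) (hq : ‖q‖ < 1) (hz : z ≠ 0)
    (hζ : IsPrimitiveRoot ζ a) (j : Fin a) :
    ∑ k ∈ range a, ∏ i : Fin a, ∑' m,
        thetaTerm q (ζ ^ k * (ζ ^ (i : ℕ) * if i = j then z else 1)) m =
      a * Eprod q ^ a * thetaProd q z * (Eprod (q ^ a) / Eprod q) ^ 2 := by
  have ha : a ≠ 0 := by rintro rfl; exact j.elim0
  have hζ0 : ζ ≠ 0 := hζ.ne_zero ha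
  have hθ (k : ℕ) (i : Fin a) :
      ∑' m, thetaTerm q (ζ ^ k * (ζ ^ (i : ℕ) * if i = j then z else 1)) m =
        Eprod q * thetaProd q (ζ ^ k * (ζ ^ (i : ℕ) * if i = j then z else 1)) := by
    refine tsum_thetaTerm hq0 hq ?_
    split_ifs <;> simp [hζ0, hz]
  simp only [hθ, prod_mul_distrib, prod_const, card_univ, Fintype.card_fin, ← mul_sum]
  have hj := j.2
  rw [sum_eq_single_of_mem (if j.1 = 0 then 0 else a - j)
    (mem_range.mpr (by split_ifs <;> omega))]
  · have hinv : ζ ^ (if j.1 = 0 then 0 else a - j) = (ζ ^ (j : ℕ))⁻¹ := by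
      split_ifs with h
      · simp [h]
      · refine eq_inv_of_mul_eq_one_left ?_
        rw [← pow_add, Nat.sub_add_cancel hj.le,
          hζ.pow_eq_one]
    rw [hinv, ← mul_prod_erase univ _ (mem_univ j), if_pos rfl,
      inv_mul_cancel_left₀ (pow_ne_zero _ hζ0)]
    have : ∏ i ∈ univ.erase j,
        thetaProd q ((ζ ^ (j : ℕ))⁻¹ * (ζ ^ (i : ℕ) * if i = j then z else 1)) =
          ∏ i ∈ univ.erase j, thetaProd q (ζ ^ (i : ℕ) * (ζ ^ (j : ℕ))⁻¹) :=
      prod_congr rfl fun i hi => by rw [if_neg (ne_of_mem_erase hi), mul_one, mul_comm]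
    rw [this, prod_erase_thetaProd hq hζ]
    ring
  · intro k hk hkj
    have hk := mem_range.mp hk
    have hi : (if k = 0 then 0 else a - k) < a := by split_ifs <;> omega
    refine prod_eq_zero (mem_univ ⟨_, hi⟩) ?_
    have hne : (⟨_, hi⟩ : Fin a) ≠ j := by
      intro h
      have h := congrArg Fin.val h
      simp only at h
      split_ifs at h hkj <;> omega
    rw [if_neg hne, mul_one, ← pow_add]
    have : ζ ^ (k + if k = 0 then 0 else a - k) = 1 := by
      split_ifs with h
      · simp [h]
      · rw [Nat.add_sub_cancel' hk.le, hζ.pow_eq_one]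
    rw [this, thetaProd_one]

lemma tsum_sumZero_mul_theta {q ζ z : ℂ} {a : ℕ} (hq0 : q ≠ 0) (hq : ‖q‖ < 1) (hz : z ≠ 0)
    (hζ : IsPrimitiveRoot ζ a) (j : Fin a) :
    (∑' v : {v : Fin a → ℤ // ∑ i, v i = 0},
        z ^ v.1 j * ζ ^ (∑ i, (i.1 : ℤ) * v.1 i) * q ^ ((∑ i, v.1 i ^ 2) / 2)) *
      (Eprod (q ^ a) * thetaProd (q ^ a) z) =
    Eprod q ^ a * thetaProd q z * (Eprod (q ^ a) / Eprod q) ^ 2 := by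
  have ha : a ≠ 0 := by rintro rfl; exact j.elim0
  have hζ0 : ζ ≠ 0 := hζ.ne_zero ha
  have hqa : ‖q ^ a‖ < 1 := by
    rw [norm_pow]
    exact pow_lt_one₀ (norm_nonneg q) hq ha
  let u : Fin a → ℂ := fun i => ζ ^ (i : ℕ) * if i = j then z else 1
  have hu (i : Fin a) : u i ≠ 0 := by
    simp only [u]
    split_ifs <;> simp [hζ0, hz]
  have h := sum_prod_tsum_thetaTerm hq0 hq ha hζ u hu
  have hs := (summable_prod_thetaTerm hq0 hq u hu).subtype {p | (a : ℤ) ∣ ∑ i, p i}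
  have hs' := (sumZeroProdEquiv ha).summable_iff.mpr hs
  rw [sum_prod_theta_eq_single hq0 hq hz hζ j, ← (sumZeroProdEquiv ha).tsum_eq,
    mul_assoc, mul_assoc] at h
  have h := mul_left_cancel₀ (Nat.cast_ne_zero.mpr ha) h
  rw [mul_assoc, h]
  refine Eq.trans ?_ hs'.tsum_prod.symm
  rw [← tsum_thetaTerm (pow_ne_zero a hq0) hqa hz, ← tsum_mul_right]
  refine tsum_congr fun v => ?_
  rw [← tsum_mul_left]
  exact tsum_congr fun m => (prod_thetaTerm_add hq0 hz hζ j v.1 v.2 m).symm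

lemma thetaProd_ne_zero {q z : ℂ} (hq : ‖q‖ < 1) (h : ∀ k : ℤ, z ≠ q ^ k) :
    thetaProd q z ≠ 0 := by
  rw [thetaProd, (multipliable_one_sub_mul_pow hq z).tprod_mul
    (multipliable_one_sub_mul_pow_succ hq z⁻¹)]
  refine mul_ne_zero (tprod_one_sub_mul_pow_ne_zero hq z fun n hn => h (-n) ?_) ?_
  · rw [zpow_neg, zpow_natCast]
    exact eq_inv_of_mul_eq_one_left hn
  · have := tprod_one_sub_mul_pow_ne_zero hq (z⁻¹ * q) fun n hn => h (n + 1 : ℕ) ?_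
    · simpa only [mul_assoc, ← pow_succ'] using this
    · rw [mul_assoc, ← pow_succ'] at hn
      rw [zpow_natCast]
      simpa using (eq_inv_of_mul_eq_one_right hn).symm

lemma ediv_two_sum_sq_ne_zero {ι : Type*} [Fintype ι] {v : ι → ℤ} (hv : ∑ i, v i = 0)
    (hv0 : v ≠ 0) : (∑ i, v i ^ 2) / 2 ≠ 0 := by
  obtain ⟨i, hi⟩ := Function.ne_iff.mp hv0
  have h₁ : 0 < ∑ i, v i ^ 2 :=
    sum_pos' (fun i _ => sq_nonneg _) ⟨i, mem_univ i, sq_pos_of_ne_zero hi⟩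
  have h₂ : (2 : ℤ) ∣ ∑ i, v i ^ 2 := by
    have : ∑ i, v i ^ 2 = ∑ i, v i * (v i - 1) := by
      simp [mul_sub, sum_sub_distrib, hv, sq]
    rw [this]
    exact dvd_sum fun i _ => ⟨tri (v i), (two_mul_tri _).symm⟩
  omega

/-- Theorem 2 (Berkovich–Garvan): for integers `a ≥ 2`, `0 ≤ j ≤ a-1`,
`ω = exp(2πi/a)`, `z ≠ 0`, `|q| < 1` (with `z` avoiding the zeros
`q^k`, `k ∈ ℤ`, of the denominator),
`∑_{n ∈ ℤᵃ, n·1=0} z^{nⱼ} ω^{b_a·n} q^{(1/2) n·n}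
 = E(q)^{a-2} E(q^a) ∏_{n ≥ 1} (1-zq^{n-1})(1-z⁻¹qⁿ) /
   ((1-zq^{a(n-1)})(1-z⁻¹q^{an}))`. -/
theorem z_analogue_conjugate_klyachko (a j : ℕ) (ha : 2 ≤ a) (hj : j < a)
    (z q : ℂ) (hz : z ≠ 0) (hq : ‖q‖ < 1) (hzq : ∀ k : ℤ, z ≠ q ^ k) :
    ∑' v : {v : Fin a → ℤ // ∑ i, v i = 0},
        z ^ (v.1 ⟨j, hj⟩) *
          (Complex.exp (2 * Real.pi * Complex.I / a)) ^ (∑ i, (i.1 : ℤ) * v.1 i) *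
          q ^ ((∑ i, (v.1 i) ^ 2) / 2) =
      Eprod q ^ (a - 2) * Eprod (q ^ a) *
        ∏' n : ℕ, ((1 - z * q ^ n) * (1 - z⁻¹ * q ^ (n + 1))) /
          ((1 - z * (q ^ a) ^ n) * (1 - z⁻¹ * (q ^ a) ^ (n + 1))) := by
  have ha0 : a ≠ 0 := by omega
  rcases eq_or_ne q 0 with rfl | hq0
  · have hz1 : 1 - z ≠ 0 := sub_ne_zero.mpr fun h => hzq 0 (by simpa using h.symm)
    have hE : Eprod 0 = 1 := by simp [Eprod]
    rw [tsum_eq_single ⟨0, by simp⟩, tprod_eq_mulSingle 0]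
    · simp [hE, ha0, hz1]
    · intro n hn
      simp [hn, ha0]
    · intro v hv
      rw [zero_zpow _ (ediv_two_sum_sq_ne_zero v.2 fun h => hv (Subtype.ext h)), mul_zero]
  have hζ := Complex.isPrimitiveRoot_exp a ha0
  have hqa : ‖q ^ a‖ < 1 := by
    rw [norm_pow]
    exact pow_lt_one₀ (norm_nonneg q) hq ha0
  have hE := Eprod_ne_zero hq
  have hEa := Eprod_ne_zero hqa
  have hP : thetaProd (q ^ a) z ≠ 0 := thetaProd_ne_zero hqa fun k => by
    rw [← zpow_natCast, ← zpow_mul]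
    exact hzq _
  have key := tsum_sumZero_mul_theta hq0 hq hz hζ ⟨j, hj⟩
  rw [(multipliable_thetaProd hq z).tprod_div₀ (multipliable_thetaProd hqa z) hP]
  change _ = Eprod q ^ (a - 2) * Eprod (q ^ a) * (thetaProd q z / thetaProd (q ^ a) z)
  rw [← eq_div_iff (mul_ne_zero hEa hP)] at key
  obtain ⟨b, rfl⟩ := Nat.exists_eq_add_of_le' ha
  rw [key, Nat.add_sub_cancel, pow_add]
  field_simp
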